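/- Let A be a finite-dimensional G-graded K-algebra, where G is a finite group with char K ∤ |G|. Then A is quasi-Koszul if and only if the smash product A # G^* is quasi-Koszul. -/

import Mathlib

open CategoryTheory

universe u

noncomputable instance (A : Type u) [Ring A] : HasDerivedCategory (ModuleCat.{u} A) :=
  HasDerivedCategory.standard _

instance (A : Type u) [Ring A] : HasExt.{u+1} (ModuleCat.{u} A) :=
  CategoryTheory.hasExt_of_hasDerivedCategory _

/-- The Jacobson radical of a ring, as a left ideal. -/
def jacRad (A : Type u) [Ring A] : Ideal A := Ideal.jacobson ⊥

/-- The semisimple quotient `A/J(A)` as a left `A`-module. -/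
abbrev ssQuot (A : Type u) [Ring A] : ModuleCat.{u} A :=
  ModuleCat.of A (A ⧸ jacRad A)

/-- A ring is semiperfect if `A/J(A)` is semisimple and idempotents lift
modulo the Jacobson radical. -/
def IsSemiperfectRing (A : Type u) [Ring A] : Prop :=
  IsSemisimpleModule A (A ⧸ jacRad A) ∧
    ∀ a : A, a * a - a ∈ jacRad A →
      ∃ e : A, IsIdempotentElem e ∧ e - a ∈ jacRad A

/-- Additive span of Yoneda products. -/
noncomputable def extSpan {C : Type (u+1)} [Category C] [Abelian C] [HasExt.{u+1} C]
    (X Y Z : C) (r l : ℕ) : AddSubgroup (Abelian.Ext X Z (r + l)) :=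
  AddSubgroup.closure { γ | ∃ (α : Abelian.Ext X Y r) (β : Abelian.Ext Y Z l), γ = α.comp β rfl }

/-- A ring `A` is quasi-Koszul if its Yoneda algebra `Ext^*_A(A/J, A/J)` is generated in
degrees 0 and 1: `Ext^i · Ext^1 = Ext^{i+1}` for all `i ≥ 0`. -/
def IsQuasiKoszul (A : Type u) [Ring A] : Prop :=
  ∀ i : ℕ, extSpan (ssQuot A) (ssQuot A) (ssQuot A) i 1 = ⊤

/-- An `A`-module `M` is quasi-Koszul if
`Ext^i_A(M, A/J) · Ext^1_A(A/J, A/J) = Ext^{i+1}_A(M, A/J)` for all `i ≥ 0`. -/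
def IsQuasiKoszulModule (A : Type u) [Ring A] (M : ModuleCat.{u} A) : Prop :=
  ∀ i : ℕ, extSpan M (ssQuot A) (ssQuot A) i 1 = ⊤

/-- `B` is a smash product `A # G^*` of the `G`-graded `K`-algebra `A` (with grading `𝒜`)
with the dual of the group algebra of the finite group `G` : `B` contains `A`, and a
complete family of orthogonal idempotents `u g` (the images of the dual basis `p_g`)
satisfying the smash commutation rule `(1 # p_g)(a # p_h) = a_{gh⁻¹} # p_h`, and `B` is
free as an `A`-module with basis the `u g`. -/
structure IsSmashProduct (K : Type u) [Field K] (A : Type u) [Ring A] [Algebra K A]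
    (G : Type u) [Group G] [Fintype G] [DecidableEq G]
    (𝒜 : G → Submodule K A) [DirectSum.Decomposition 𝒜]
    (B : Type u) [Ring B] [Algebra K B] where
  ι : A →ₐ[K] B
  u : G → B
  idem : ∀ g : G, u g * u g = u g
  orth : ∀ g h : G, g ≠ h → u g * u h = 0
  sum_u : ∑ g : G, u g = 1
  comm : ∀ (g h : G) (a : A),
    u g * (ι a * u h) = ι ((DirectSum.decompose 𝒜 a (g * h⁻¹) : 𝒜 (g * h⁻¹)) : A) * u h
  free : ∀ b : B, ∃! c : G → A, b = ∑ g : G, ι (c g) * u g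

section ExtTransfer

open Abelian Limits

variable {C D : Type (u + 1)} [Category.{u} C] [Abelian C] [HasExt.{u + 1} C]
  [Category.{u} D] [Abelian D] [HasExt.{u + 1} D]

lemma extSpan_comp_mem {X Y Z : C} {r l : ℕ} (α : Ext X Y r) (β : Ext Y Z l) :
    α.comp β rfl ∈ extSpan X Y Z r l :=
  AddSubgroup.subset_closure ⟨α, β, rfl⟩

lemma mk₀_comp_mem_extSpan {X X' Y Z : C} {r l : ℕ} (f : X' ⟶ X) {γ : Ext X Z (r + l)}
    (hγ : γ ∈ extSpan X Y Z r l) :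
    (Ext.mk₀ f).comp γ (zero_add _) ∈ extSpan X' Y Z r l := by
  induction hγ using AddSubgroup.closure_induction with
  | mem γ h =>
    obtain ⟨α, β, rfl⟩ := h
    rw [← Ext.comp_assoc (Ext.mk₀ f) α β (zero_add r) rfl (by lia)]
    exact extSpan_comp_mem _ _
  | zero => simp
  | add _ _ _ _ h₁ h₂ => simpa using add_mem h₁ h₂
  | neg _ _ h => simpa using h

lemma comp_mk₀_mem_extSpan {X Y Z Z' : C} {r l : ℕ} (f : Z ⟶ Z') {γ : Ext X Z (r + l)}
    (hγ : γ ∈ extSpan X Y Z r l) :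
    γ.comp (Ext.mk₀ f) (add_zero _) ∈ extSpan X Y Z' r l := by
  induction hγ using AddSubgroup.closure_induction with
  | mem γ h =>
    obtain ⟨α, β, rfl⟩ := h
    rw [Ext.comp_assoc α β (Ext.mk₀ f) rfl (add_zero l) (by lia)]
    exact extSpan_comp_mem _ _
  | zero => simp
  | add _ _ _ _ h₁ h₂ => simpa using add_mem h₁ h₂
  | neg _ _ h => simpa using h

/-- The object `X` is a direct summand of a finite power of `T`: the identity of `X` is a finite
sum of endomorphisms factoring through `T`. -/
def IsSummandOfPower (X T : C) : Prop :=
  ∃ (n : ℕ) (q : Fin n → (X ⟶ T)) (p : Fin n → (T ⟶ X)), ∑ k, q k ≫ p k = 𝟙 X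

lemma extSpan_le_of_isSummandOfPower {X Y Z T : C} (h : IsSummandOfPower Y T) (r l : ℕ) :
    extSpan X Y Z r l ≤ extSpan X T Z r l := by
  obtain ⟨n, q, p, hqp⟩ := h
  refine (AddSubgroup.closure_le _).2 ?_
  rintro _ ⟨α, β, rfl⟩
  have : β = ∑ k, (Ext.mk₀ (q k)).comp ((Ext.mk₀ (p k)).comp β (zero_add l)) (zero_add l) := by
    simp_rw [Ext.mk₀_comp_mk₀_assoc]
    rw [← Ext.sum_comp, ← Ext.mk₀_sum, hqp, Ext.mk₀_id_comp]
  rw [this, Ext.comp_sum]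
  refine sum_mem fun k _ ↦ ?_
  rw [← Ext.comp_assoc α (Ext.mk₀ (q k)) _ (add_zero r) (zero_add l) (by lia)]
  exact extSpan_comp_mem _ _

lemma extSpan_eq_top_of_isSummandOfPower {X T Y Z : C} {r l : ℕ} (hX : IsSummandOfPower X T)
    (hZ : IsSummandOfPower Z T) (h : extSpan T Y T r l = ⊤) : extSpan X Y Z r l = ⊤ := by
  obtain ⟨n, q, p, hqp⟩ := hX
  obtain ⟨m, q', p', hqp'⟩ := hZ
  rw [eq_top_iff]
  intro γ _
  have h₁ : γ = ∑ k, (Ext.mk₀ (q k)).comp ((Ext.mk₀ (p k)).comp γ (zero_add _)) (zero_add _) := by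
    simp_rw [Ext.mk₀_comp_mk₀_assoc]
    rw [← Ext.sum_comp, ← Ext.mk₀_sum, hqp, Ext.mk₀_id_comp]
  have h₂ (δ : Ext T Z (r + l)) :
      δ = ∑ k, (δ.comp (Ext.mk₀ (q' k)) (add_zero _)).comp (Ext.mk₀ (p' k)) (add_zero _) := by
    have hk (k) : (δ.comp (Ext.mk₀ (q' k)) (add_zero _)).comp (Ext.mk₀ (p' k)) (add_zero _) =
        δ.comp (Ext.mk₀ (q' k ≫ p' k)) (add_zero _) := by
      rw [Ext.comp_assoc_of_third_deg_zero, Ext.mk₀_comp_mk₀]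
    simp_rw [hk]
    rw [← Ext.comp_sum, ← Ext.mk₀_sum, hqp', Ext.comp_mk₀_id]
  rw [h₁]
  refine sum_mem fun k _ ↦ mk₀_comp_mem_extSpan _ ?_
  rw [h₂ ((Ext.mk₀ (p k)).comp γ (zero_add _))]
  refine sum_mem fun j _ ↦ comp_mk₀_mem_extSpan _ ?_
  rw [h]
  trivial

lemma mapExactFunctor_mem_extSpan (F : C ⥤ D) [F.Additive] [PreservesFiniteLimits F]
    [PreservesFiniteColimits F] {X Y Z : C} {r l : ℕ} {γ : Ext X Z (r + l)}
    (hγ : γ ∈ extSpan X Y Z r l) :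
    γ.mapExactFunctor F ∈ extSpan (F.obj X) (F.obj Y) (F.obj Z) r l := by
  suffices extSpan X Y Z r l ≤ (extSpan (F.obj X) (F.obj Y) (F.obj Z) r l).comap
      (F.mapExtAddHom X Z (r + l)) from this hγ
  refine (AddSubgroup.closure_le _).2 ?_
  rintro _ ⟨α, β, rfl⟩
  simpa [Ext.mapExactFunctor_comp] using extSpan_comp_mem _ _

/-- The action of exact functors on `Ext` is natural with respect to natural transformations. -/
lemma mapExactFunctor_naturality [EnoughProjectives C] {F F' : C ⥤ D} [F.Additive]
    [PreservesFiniteLimits F] [PreservesFiniteColimits F] [F'.Additive]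
    [PreservesFiniteLimits F'] [PreservesFiniteColimits F'] (τ : F ⟶ F') {X Z : C} {n : ℕ}
    (γ : Ext X Z n) :
    (γ.mapExactFunctor F).comp (Ext.mk₀ (τ.app Z)) (add_zero n) =
      (Ext.mk₀ (τ.app X)).comp (γ.mapExactFunctor F') (zero_add n) := by
  induction n generalizing X with
  | zero =>
    obtain ⟨f, rfl⟩ := (Ext.mk₀_bijective _ _).2 γ
    simp [Ext.mapExactFunctor_mk₀]
  | succ n hn =>
    let P : ProjectivePresentation X := Classical.arbitrary _
    let S := ShortComplex.mk _ _ (kernel.condition P.f)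
    have hS : S.ShortExact := { exact := ShortComplex.exact_kernel P.f }
    have : Projective S.X₂ := P.projective
    obtain ⟨δ, rfl⟩ := Ext.contravariant_sequence_exact₃ hS Z γ
      (Ext.eq_zero_of_projective _) (add_comm 1 n)
    have nat : (hS.extClass.mapExactFunctor F).comp (Ext.mk₀ (τ.app S.X₁)) (add_zero 1) =
        (Ext.mk₀ (τ.app S.X₃)).comp (hS.extClass.mapExactFunctor F') (zero_add 1) := by
      rw [Ext.mapExactFunctor_extClass, Ext.mapExactFunctor_extClass]
      exact ShortComplex.ShortExact.extClass_naturality (hS.map_of_exact F)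
        (hS.map_of_exact F') (S.mapNatTrans τ)
    rw [Ext.mapExactFunctor_comp, Ext.mapExactFunctor_comp, Ext.comp_assoc_of_third_deg_zero, hn,
      ← Ext.comp_assoc_of_second_deg_zero, nat]
    exact Ext.comp_assoc _ _ _ (zero_add 1) (add_comm 1 n) (by lia)

lemma mapExactFunctor_id [EnoughProjectives C] {X Z : C} {n : ℕ} (γ : Ext X Z n) :
    γ.mapExactFunctor (𝟭 C) = γ := by
  induction n generalizing X with
  | zero =>
    obtain ⟨f, rfl⟩ := (Ext.mk₀_bijective _ _).2 γ
    simp [Ext.mapExactFunctor_mk₀]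
  | succ n hn =>
    let P : ProjectivePresentation X := Classical.arbitrary _
    let S := ShortComplex.mk _ _ (kernel.condition P.f)
    have hS : S.ShortExact := { exact := ShortComplex.exact_kernel P.f }
    have : Projective S.X₂ := P.projective
    obtain ⟨δ, rfl⟩ := Ext.contravariant_sequence_exact₃ hS Z γ
      (Ext.eq_zero_of_projective _) (add_comm 1 n)
    rw [Ext.mapExactFunctor_comp, Ext.mapExactFunctor_extClass, hn]
    rfl

lemma mapExactFunctor_functor_comp [EnoughProjectives C] (F : C ⥤ D) [F.Additive]
    [PreservesFiniteLimits F] [PreservesFiniteColimits F] (H : D ⥤ C) [H.Additive]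
    [PreservesFiniteLimits H] [PreservesFiniteColimits H] [PreservesFiniteLimits (F ⋙ H)]
    [PreservesFiniteColimits (F ⋙ H)] {X Z : C} {n : ℕ} (γ : Ext X Z n) :
    γ.mapExactFunctor (F ⋙ H) = (γ.mapExactFunctor F).mapExactFunctor H := by
  induction n generalizing X with
  | zero =>
    obtain ⟨f, rfl⟩ := (Ext.mk₀_bijective _ _).2 γ
    simp [Ext.mapExactFunctor_mk₀]
  | succ n hn =>
    let P : ProjectivePresentation X := Classical.arbitrary _
    let S := ShortComplex.mk _ _ (kernel.condition P.f)
    have hS : S.ShortExact := { exact := ShortComplex.exact_kernel P.f }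
    have : Projective S.X₂ := P.projective
    obtain ⟨δ, rfl⟩ := Ext.contravariant_sequence_exact₃ hS Z γ
      (Ext.eq_zero_of_projective _) (add_comm 1 n)
    have comp : hS.extClass.mapExactFunctor (F ⋙ H) =
        (hS.extClass.mapExactFunctor F).mapExactFunctor H := by
      rw [Ext.mapExactFunctor_extClass, Ext.mapExactFunctor_extClass]
      exact (Ext.mapExactFunctor_extClass H (hS.map_of_exact F)).symm
    rw [Ext.mapExactFunctor_comp, Ext.mapExactFunctor_comp, Ext.mapExactFunctor_comp, hn, comp]

/-- Generation of `Ext` by products of low degree passes along a pair of exact functors of which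
one composite has the identity as a natural retract. -/
theorem extSpan_eq_top_of_retract [EnoughProjectives C] (F : C ⥤ D) [F.Additive]
    [PreservesFiniteLimits F] [PreservesFiniteColimits F] (H : D ⥤ C) [H.Additive]
    [PreservesFiniteLimits H] [PreservesFiniteColimits H] (s : 𝟭 C ⟶ F ⋙ H) (t : F ⋙ H ⟶ 𝟭 C)
    (hst : s ≫ t = 𝟙 _) {S : C} {T : D} (hS : IsSummandOfPower (F.obj S) T)
    (hT : IsSummandOfPower (H.obj T) S) {r l : ℕ} (h : extSpan T T T r l = ⊤) :
    extSpan S S S r l = ⊤ := by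
  rw [eq_top_iff]
  intro γ _
  have h₁ : γ.mapExactFunctor F ∈ extSpan (F.obj S) T (F.obj S) r l := by
    rw [extSpan_eq_top_of_isSummandOfPower hS hS h]
    trivial
  have h₂ := extSpan_le_of_isSummandOfPower hT r l (mapExactFunctor_mem_extSpan H h₁)
  have : PreservesFiniteLimits (F ⋙ H) := comp_preservesFiniteLimits F H
  have : PreservesFiniteColimits (F ⋙ H) := comp_preservesFiniteColimits F H
  rw [← mapExactFunctor_functor_comp F H γ] at h₂
  have h₃ := mk₀_comp_mem_extSpan (s.app S) (comp_mk₀_mem_extSpan (t.app S) h₂)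
  rw [mapExactFunctor_naturality t γ, Ext.mk₀_comp_mk₀_assoc, ← NatTrans.comp_app, hst,
    mapExactFunctor_id] at h₃
  simpa using h₃

end ExtTransfer

section Exactness

open Limits

variable {R S : Type u} [Ring R] [Ring S]

lemma exact_of_forall_function_exact (F : ModuleCat.{u} R ⥤ ModuleCat.{u} S) [F.Additive]
    (hF : ∀ T : ShortComplex (ModuleCat.{u} R), Function.Exact T.f T.g →
      Function.Exact (F.map T.f) (F.map T.g)) :
    PreservesFiniteLimits F ∧ PreservesFiniteColimits F := by
  refine (F.exact_tfae.out 1 3).mp fun T hT ↦ ?_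
  rw [ShortComplex.ShortExact.moduleCat_exact_iff_function_exact] at hT ⊢
  exact hF T hT

lemma exact_restrictScalars (f : R →+* S) :
    PreservesFiniteLimits (ModuleCat.restrictScalars.{u} f) ∧
      PreservesFiniteColimits (ModuleCat.restrictScalars.{u} f) :=
  exact_of_forall_function_exact _ fun _ hT ↦ hT

instance (G : Type u) [Fintype G] [DecidableEq G] :
    (ModuleCat.toMatrixModCat R G : ModuleCat.{u} R ⥤ ModuleCat.{u} _).Additive where
  map_add := rfl

lemma exact_toMatrixModCat (G : Type u) [Fintype G] [DecidableEq G] :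
    PreservesFiniteLimits (ModuleCat.toMatrixModCat R G : ModuleCat.{u} R ⥤ ModuleCat.{u} _) ∧
      PreservesFiniteColimits
        (ModuleCat.toMatrixModCat R G : ModuleCat.{u} R ⥤ ModuleCat.{u} _) :=
  exact_of_forall_function_exact _ fun T hT (y : G → T.X₂) ↦ by
    constructor
    · intro hy
      choose x hx using fun k : G ↦ (hT (y k)).1 (congr_fun hy k)
      exact ⟨x, funext hx⟩
    · rintro ⟨(x : G → T.X₁), rfl⟩
      exact funext fun k ↦ (hT _).2 ⟨x k, rfl⟩

end Exactness

section Semisimple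

variable {A : Type u} [Ring A]

lemma jacRad_eq_jacobson : jacRad A = Ring.jacobson A := Ideal.jacobson_bot

instance : (jacRad A).IsTwoSided := jacRad_eq_jacobson (A := A) ▸ inferInstance

lemma isSemisimpleModule_quotient_jacRad [IsArtinianRing A] :
    IsSemisimpleModule A (A ⧸ jacRad A) := by
  rw [jacRad_eq_jacobson, IsArtinian.isSemisimpleModule_iff_jacobson]
  exact Module.jacobson_quotient_jacobson A A

lemma exists_surjective_of_jacRad_smul_eq_zero {M : Type u} [AddCommGroup M] [Module A M]
    [Module.Finite A M] (hM : ∀ a ∈ jacRad A, ∀ m : M, a • m = 0) :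
    ∃ (n : ℕ) (f : (Fin n → A ⧸ jacRad A) →ₗ[A] M), Function.Surjective f := by
  obtain ⟨n, s, hs⟩ := Module.Finite.exists_fin (R := A) (M := M)
  refine ⟨n, LinearMap.lsum A _ ℕ fun i ↦
    (jacRad A).liftQ (LinearMap.toSpanSingleton A M (s i)) fun a ha ↦ hM a ha _, ?_⟩
  rw [← LinearMap.range_eq_top, eq_top_iff, ← hs, Submodule.span_le]
  rintro _ ⟨i, rfl⟩
  refine ⟨Pi.single i (Submodule.Quotient.mk 1), ?_⟩
  rw [LinearMap.lsum_piSingle]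
  exact one_smul A (s i)

lemma isSemisimpleModule_of_jacRad_smul_eq_zero [IsArtinianRing A] {M : Type u} [AddCommGroup M]
    [Module A M] [Module.Finite A M] (hM : ∀ a ∈ jacRad A, ∀ m : M, a • m = 0) :
    IsSemisimpleModule A M := by
  obtain ⟨n, f, hf⟩ := exists_surjective_of_jacRad_smul_eq_zero hM
  have := isSemisimpleModule_quotient_jacRad (A := A)
  exact IsSemisimpleModule.of_surjective f hf

lemma isSummandOfPower_ssQuot [IsArtinianRing A] (M : ModuleCat.{u} A) [Module.Finite A M]
    (hM : ∀ a ∈ jacRad A, ∀ m : M, a • m = 0) : IsSummandOfPower M (ssQuot A) := by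
  obtain ⟨n, f, hf⟩ := exists_surjective_of_jacRad_smul_eq_zero hM
  have := isSemisimpleModule_quotient_jacRad (A := A)
  obtain ⟨g, hg⟩ := IsSemisimpleModule.lifting_property f hf LinearMap.id
  refine ⟨n, fun k ↦ ModuleCat.ofHom (LinearMap.proj k ∘ₗ g),
    fun k ↦ ModuleCat.ofHom (f ∘ₗ LinearMap.single A (fun _ ↦ A ⧸ jacRad A) k), ?_⟩
  ext m
  have : ∑ k, Pi.single k (g m k) = g m := Finset.univ_sum_single (g m)
  simp only [ModuleCat.hom_sum, ModuleCat.hom_comp, ModuleCat.hom_ofHom, LinearMap.sum_apply,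
    LinearMap.comp_apply, LinearMap.proj_apply, LinearMap.single_apply, ModuleCat.hom_id,
    LinearMap.id_apply]
  rw [← map_sum, this]
  exact LinearMap.congr_fun hg m

end Semisimple

lemma DirectSum.sum_univ_decompose {K A G : Type*} [Semiring K] [AddCommMonoid A] [Module K A]
    [Fintype G] [DecidableEq G] {𝒜 : G → Submodule K A} [DirectSum.Decomposition 𝒜] (a : A) : ∑ g, ((DirectSum.decompose 𝒜 a g : 𝒜 g) : A) = a := by
  classical
  conv_rhs => rw [← DirectSum.sum_support_decompose 𝒜 a]
  refine (Finset.sum_subset (Finset.subset_univ _) fun g _ hg ↦ ?_).symm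
  simpa using hg

namespace IsSmashProduct

open scoped Matrix.Module

variable {K : Type u} [Field K] {A : Type u} [Ring A] [Algebra K A]
    {G : Type u} [Group G] [Fintype G] [DecidableEq G]
    {𝒜 : G → Submodule K A} [DirectSum.Decomposition 𝒜]
    {B : Type u} [Ring B] [Algebra K B]
    (HS : IsSmashProduct K A G 𝒜 B)

lemma ι_mul_u_injective (h : G) {a a' : A} (e : HS.ι a * HS.u h = HS.ι a' * HS.u h) :
    a = a' := by
  have hs (x : A) : HS.ι x * HS.u h = ∑ g, HS.ι (Pi.single (M := fun _ ↦ A) h x g) * HS.u g := by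
    rw [Finset.sum_eq_single h]
    · simp
    · intro g _ hg
      simp [hg]
    · simp
  have := (HS.free (HS.ι a * HS.u h)).unique (hs a) (e.trans (hs a'))
  simpa using congr_fun this h

lemma exists_entry (b : B) (k h : G) : ∃ a ∈ 𝒜 (k * h⁻¹), HS.u k * b * HS.u h = HS.ι a * HS.u h := by
  obtain ⟨c, rfl, -⟩ := HS.free b
  refine ⟨(DirectSum.decompose 𝒜 (c h) (k * h⁻¹) : 𝒜 (k * h⁻¹)), SetLike.coe_mem _, ?_⟩
  rw [← HS.comm, mul_assoc, Finset.sum_mul, Finset.sum_eq_single h]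
  · rw [mul_assoc, HS.idem]
  · intro g _ hg
    rw [mul_assoc, HS.orth g h hg, mul_zero]
  · simp

/-- The matrix entries of an element `b` of the smash product: `u k * b * u h = entry b k h * u h`
with `entry b k h` homogeneous of degree `k * h⁻¹`. -/
noncomputable def entry (b : B) (k h : G) : A := (HS.exists_entry b k h).choose

lemma entry_mem (b : B) (k h : G) : HS.entry b k h ∈ 𝒜 (k * h⁻¹) :=
  (HS.exists_entry b k h).choose_spec.1

lemma u_mul_mul_u (b : B) (k h : G) : HS.u k * b * HS.u h = HS.ι (HS.entry b k h) * HS.u h :=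
  (HS.exists_entry b k h).choose_spec.2

lemma entry_eq {b : B} {k h : G} {a : A} (e : HS.u k * b * HS.u h = HS.ι a * HS.u h) :
    HS.entry b k h = a :=
  HS.ι_mul_u_injective h ((HS.u_mul_mul_u b k h).symm.trans e)

lemma u_mul_u (g h : G) : HS.u g * HS.u h = if g = h then HS.u h else 0 := by
  split_ifs with e
  · rw [e, HS.idem]
  · exact HS.orth g h e

/-- The embedding of the smash product into matrices over `A`. -/
noncomputable def toMatrix : B →+* Matrix G G A where
  toFun b := Matrix.of (HS.entry b)
  map_one' := by
    ext k h
    apply HS.entry_eq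
    rw [mul_one, u_mul_u, Matrix.one_apply]
    split_ifs <;> simp
  map_zero' := by
    ext k h
    apply HS.entry_eq
    simp
  map_add' b b' := by
    ext k h
    apply HS.entry_eq
    rw [mul_add, add_mul, u_mul_mul_u, u_mul_mul_u]
    simp [add_mul]
  map_mul' b b' := by
    ext k h
    apply HS.entry_eq
    have (l : G) : HS.u k * b * HS.u l * b' * HS.u h =
        HS.ι (HS.entry b k l) * HS.ι (HS.entry b' l h) * HS.u h := by
      rw [mul_assoc _ (HS.ι (HS.entry b' l h)), ← HS.u_mul_mul_u b' l h, HS.u_mul_mul_u b k l]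
      simp only [mul_assoc]
    calc HS.u k * (b * b') * HS.u h = HS.u k * b * (∑ l, HS.u l) * b' * HS.u h := by
          rw [HS.sum_u]; simp only [mul_one, mul_assoc]
      _ = _ := by
          simp only [Finset.mul_sum, Finset.sum_mul, this, Matrix.mul_apply, map_sum, map_mul,
            Matrix.of_apply]

lemma toMatrix_apply (b : B) (k h : G) : HS.toMatrix b k h = HS.entry b k h := rfl

lemma sum_entry (b : B) : b = ∑ k, ∑ h, HS.ι (HS.entry b k h) * HS.u h := by
  simp_rw [← u_mul_mul_u, ← Finset.mul_sum, HS.sum_u, mul_one, ← Finset.sum_mul, HS.sum_u, one_mul]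

lemma toMatrix_injective : Function.Injective HS.toMatrix := by
  intro b b' e
  rw [HS.sum_entry b, HS.sum_entry b']
  simp_rw [← toMatrix_apply, e]

lemma entry_ι (a : A) (k h : G) :
    HS.entry (HS.ι a) k h = (DirectSum.decompose 𝒜 a (k * h⁻¹) : 𝒜 (k * h⁻¹)) := by
  apply HS.entry_eq
  rw [mul_assoc, HS.comm]

lemma entry_u (g k h : G) : HS.entry (HS.u g) k h = if k = g ∧ g = h then 1 else 0 := by
  apply HS.entry_eq
  rw [u_mul_u]
  split_ifs with h₁ h₂ h₂
  · obtain ⟨rfl, rfl⟩ := h₂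
    simp [HS.idem]
  · rw [u_mul_u, if_neg (fun e ↦ h₂ ⟨h₁, e⟩)]
    simp
  · exact absurd h₂.1 h₁
  · simp

lemma entry_ι_mul_u (a : A) (g k h : G) : HS.entry (HS.ι a * HS.u g) k h =
    if g = h then ((DirectSum.decompose 𝒜 a (k * h⁻¹) : 𝒜 (k * h⁻¹)) : A) else 0 := by
  apply HS.entry_eq
  rw [mul_assoc, mul_assoc, u_mul_u]
  split_ifs with e
  · rw [HS.comm]
  · simp

/-- Right translation of the idempotents of a smash product. -/
noncomputable def shiftFun (x : G) (b : B) : B :=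
  ∑ k, ∑ h, HS.ι (HS.entry b k h) * HS.u (h * x)

lemma decompose_entry (b : B) (k h g : G) :
    ((DirectSum.decompose 𝒜 (HS.entry b k h) g : 𝒜 g) : A) =
      if g = k * h⁻¹ then HS.entry b k h else 0 := by
  split_ifs with e
  · subst e
    exact DirectSum.decompose_of_mem_same 𝒜 (HS.entry_mem b k h)
  · exact DirectSum.decompose_of_mem_ne 𝒜 (HS.entry_mem b k h) (Ne.symm e)

lemma toMatrix_shiftFun (x : G) (b : B) (k h : G) :
    HS.toMatrix (HS.shiftFun x b) k h = HS.toMatrix b (k * x⁻¹) (h * x⁻¹) := by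
  have (l m : G) : HS.entry (HS.ι (HS.entry b l m) * HS.u (m * x)) k h =
      if m = h * x⁻¹ then (if l = k * x⁻¹ then HS.entry b l m else 0) else 0 := by
    rw [entry_ι_mul_u, decompose_entry]
    have h₁ : m * x = h ↔ m = h * x⁻¹ := eq_mul_inv_iff_mul_eq.symm
    by_cases e : m = h * x⁻¹
    · rw [if_pos (h₁.2 e), if_pos e]
      subst e
      have : k * h⁻¹ = l * (h * x⁻¹)⁻¹ ↔ l = k * x⁻¹ := by
        rw [mul_inv_rev, inv_inv, ← mul_assoc, mul_left_inj, eq_comm, eq_mul_inv_iff_mul_eq]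
      simp only [this]
    · rw [if_neg (mt h₁.1 e), if_neg e]
  simp_rw [shiftFun, map_sum, Matrix.sum_apply, toMatrix_apply, this]
  simp

/-- Right translation of the idempotents, as a ring homomorphism. -/
noncomputable def shift (x : G) : B →+* B where
  toFun := HS.shiftFun x
  map_one' := HS.toMatrix_injective <| by
    ext k h
    simp [toMatrix_shiftFun, Matrix.one_apply]
  map_zero' := HS.toMatrix_injective <| by
    ext k h
    simp [toMatrix_shiftFun]
  map_add' b b' := HS.toMatrix_injective <| by
    ext k h
    simp [toMatrix_shiftFun]
  map_mul' b b' := HS.toMatrix_injective <| by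
    ext k h
    simp only [toMatrix_shiftFun, map_mul, Matrix.mul_apply]
    exact (Equiv.sum_comp (Equiv.mulRight x⁻¹) fun l ↦
      HS.toMatrix b (k * x⁻¹) l * HS.toMatrix b' l (h * x⁻¹)).symm

lemma toMatrix_shift (x : G) (b : B) (k h : G) :
    HS.toMatrix (HS.shift x b) k h = HS.toMatrix b (k * x⁻¹) (h * x⁻¹) :=
  HS.toMatrix_shiftFun x b k h

lemma shift_surjective (x : G) : Function.Surjective (HS.shift x) := fun b ↦
  ⟨HS.shift x⁻¹ b, HS.toMatrix_injective <| by ext; simp [toMatrix_shift]⟩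

lemma shift_mem_jacRad (x : G) {b : B} (hb : b ∈ jacRad B) : HS.shift x b ∈ jacRad B := by
  rw [jacRad, Ideal.mem_jacobson_iff] at hb ⊢
  intro y
  obtain ⟨y, rfl⟩ := HS.shift_surjective x y
  obtain ⟨z, hz⟩ := hb y
  refine ⟨HS.shift x z, ?_⟩
  rw [Ideal.mem_bot] at hz ⊢
  rw [← map_mul, ← map_mul, ← map_add, ← map_one (HS.shift x), ← map_sub, hz, map_zero]

lemma shift_ι_mul_u (x : G) (b : B) (k h : G) :
    HS.shift x (HS.ι (HS.entry b k h) * HS.u h) = HS.ι (HS.entry b k h) * HS.u (h * x) := by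
  apply HS.toMatrix_injective
  ext l m
  rw [toMatrix_shift, toMatrix_apply, toMatrix_apply, entry_ι_mul_u, entry_ι_mul_u,
    show l * x⁻¹ * (m * x⁻¹)⁻¹ = l * m⁻¹ by group]
  simp only [eq_mul_inv_iff_mul_eq]

/-- The matrix entries of an element of the Jacobson radical of the smash product lie in it. -/
lemma ι_entry_mem_jacRad {b : B} (hb : b ∈ jacRad B) (k h : G) :
    HS.ι (HS.entry b k h) ∈ jacRad B := by
  have h₁ : HS.ι (HS.entry b k h) * HS.u h ∈ jacRad B := by
    rw [← u_mul_mul_u]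
    exact Ideal.mul_mem_right _ _ (Ideal.mul_mem_left _ _ hb)
  have h₂ : HS.ι (HS.entry b k h) = ∑ x, HS.ι (HS.entry b k h) * HS.u (h * x) := by
    have := Equiv.sum_comp (Equiv.mulLeft h) HS.u
    simp only [Equiv.coe_mulLeft, HS.sum_u] at this
    rw [← Finset.mul_sum, this, mul_one]
  rw [h₂]
  refine sum_mem fun x _ ↦ ?_
  rw [← shift_ι_mul_u]
  exact HS.shift_mem_jacRad x h₁

lemma ι_injective : Function.Injective HS.ι := fun a a' e ↦
  HS.ι_mul_u_injective 1 (by rw [e])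

lemma finiteDimensional (HS : IsSmashProduct K A G 𝒜 B) [FiniteDimensional K A] : FiniteDimensional K B := by
  refine Module.Finite.of_surjective (M := G → A)
    (∑ g, (LinearMap.mulRight K (HS.u g)) ∘ₗ HS.ι.toLinearMap ∘ₗ LinearMap.proj g) fun b ↦ ?_
  obtain ⟨c, hc, -⟩ := HS.free b
  exact ⟨c, by simp [hc]⟩

lemma comap_jacRad_le [FiniteDimensional K A] :
    (jacRad B).comap (HS.ι : A →+* B) ≤ jacRad A := by
  have := HS.finiteDimensional
  have : IsArtinianRing B := IsArtinianRing.of_finite K B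
  obtain ⟨n, hn⟩ : IsNilpotent (jacRad B) := IsArtinianRing.isNilpotent_jacobson_bot
  intro a ha
  rw [jacRad, Ideal.mem_jacobson_iff]
  intro y
  have hnil : IsNilpotent (y * a) := by
    refine ⟨n, HS.ι_injective ?_⟩
    have h₁ : HS.ι (y * a) ∈ jacRad B := by
      rw [map_mul]
      exact Ideal.mul_mem_left _ _ ha
    have h₂ := Ideal.pow_mem_pow h₁ n
    rw [hn] at h₂
    simpa using h₂
  obtain ⟨v, hv⟩ := hnil.isUnit_one_add
  refine ⟨↑v⁻¹, ?_⟩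
  have : (↑v⁻¹ : A) * (1 + y * a) = 1 := by rw [← hv, Units.inv_mul]
  rw [Ideal.mem_bot, mul_assoc, ← sub_eq_zero.2 this]
  noncomm_ring

/-- Restriction of modules over the smash product to `A`. -/
noncomputable abbrev res : ModuleCat.{u} B ⥤ ModuleCat.{u} A :=
  ModuleCat.restrictScalars (HS.ι : A →+* B)

/-- The functor sending an `A`-module `M` to `G → M`, on which the smash product acts through
matrices over `A`. It is isomorphic to induction of modules. -/
noncomputable abbrev ind : ModuleCat.{u} A ⥤ ModuleCat.{u} B :=
  ModuleCat.toMatrixModCat A G ⋙ ModuleCat.restrictScalars HS.toMatrix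

lemma ind_smul (M : ModuleCat.{u} A) (b : B) (f : HS.ind.obj M) (k : G) :
    (b • f : HS.ind.obj M) k = ∑ h, HS.entry b k h • f h := rfl

lemma sum_decompose_mul_inv_right (a : A) (k : G) :
    ∑ h, ((DirectSum.decompose 𝒜 a (k * h⁻¹) : 𝒜 (k * h⁻¹)) : A) = a :=
  (Equiv.sum_comp ((Equiv.inv G).trans (Equiv.mulLeft k))
    fun g ↦ ((DirectSum.decompose 𝒜 a g : 𝒜 g) : A)).trans (DirectSum.sum_univ_decompose a)

lemma sum_decompose_mul_inv_left (a : A) (h : G) :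
    ∑ k, ((DirectSum.decompose 𝒜 a (k * h⁻¹) : 𝒜 (k * h⁻¹)) : A) = a :=
  (Equiv.sum_comp (Equiv.mulRight h⁻¹)
    fun g ↦ ((DirectSum.decompose 𝒜 a g : 𝒜 g) : A)).trans (DirectSum.sum_univ_decompose a)

lemma u_mul_ι_entry (b : B) (k h : G) :
    HS.u k * HS.ι (HS.entry b k h) = HS.u k * b * HS.u h := by
  rw [u_mul_mul_u, ← mul_one (HS.u k * _), ← HS.sum_u, Finset.mul_sum]
  simp_rw [mul_assoc, HS.comm, decompose_entry, mul_right_inj, inv_inj]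
  rw [Finset.sum_eq_single h]
  · rw [if_pos rfl]
  · intro g _ hg
    rw [if_neg hg, map_zero, zero_mul]
  · simp

/-- The natural embedding of an `A`-module into the restriction of the induced module. -/
noncomputable def toResInd (M : ModuleCat.{u} A) : M ⟶ HS.res.obj (HS.ind.obj M) :=
  ModuleCat.ofHom (Y := HS.res.obj (HS.ind.obj M))
  { toFun := fun m _ ↦ m
    map_add' := fun _ _ ↦ rfl
    map_smul' := fun a m ↦ by
      refine funext fun k ↦ ?_
      change a • m = ∑ h, HS.entry (HS.ι a) k h • m
      simp_rw [entry_ι, ← Finset.sum_smul, sum_decompose_mul_inv_right] }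

/-- The natural map from the restriction of the induced module given by averaging coordinates. -/
noncomputable def ofResInd (M : ModuleCat.{u} A) : HS.res.obj (HS.ind.obj M) ⟶ M :=
  ModuleCat.ofHom (X := HS.res.obj (HS.ind.obj M))
  { toFun := fun f ↦ algebraMap K A (Fintype.card G : K)⁻¹ • ∑ k, (show G → M from f) k
    map_add' := fun f f' ↦ by
      rw [← smul_add, ← Finset.sum_add_distrib]
      rfl
    map_smul' := fun a f ↦ by
      change _ • ∑ k, ∑ h, HS.entry (HS.ι a) k h • (show G → M from f) h =
        a • _ • ∑ k, (show G → M from f) k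
      rw [Finset.sum_comm, ← mul_smul, ← Algebra.commutes, mul_smul, Finset.smul_sum (r := a)]
      simp_rw [entry_ι, ← Finset.sum_smul, sum_decompose_mul_inv_left] }

/-- The natural embedding of a module over the smash product into the module induced from its
restriction. -/
noncomputable def toIndRes (N : ModuleCat.{u} B) : N ⟶ HS.ind.obj (HS.res.obj N) :=
  ModuleCat.ofHom (Y := HS.ind.obj (HS.res.obj N))
  { toFun := fun n k ↦ (HS.u k • n : N)
    map_add' := fun _ _ ↦ funext fun _ ↦ smul_add _ _ _
    map_smul' := fun b n ↦ by
      refine funext fun k ↦ ?_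
      change (HS.u k • b • n : N) = ∑ h, (HS.ι (HS.entry b k h) • HS.u h • n : N)
      simp_rw [← mul_smul, ← u_mul_mul_u, ← Finset.sum_smul, ← Finset.mul_sum, HS.sum_u, mul_one] }

/-- The natural map onto a module over the smash product from the module induced from its
restriction. -/
noncomputable def ofIndRes (N : ModuleCat.{u} B) : HS.ind.obj (HS.res.obj N) ⟶ N :=
  ModuleCat.ofHom (X := HS.ind.obj (HS.res.obj N))
  { toFun := fun f ↦ ∑ k, HS.u k • (show G → N from f) k
    map_add' := fun _ _ ↦ by
      rw [← Finset.sum_add_distrib]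
      exact Finset.sum_congr rfl fun _ _ ↦ smul_add _ _ _
    map_smul' := fun b f ↦ by
      change ∑ k, HS.u k • ∑ h, HS.ι (HS.entry b k h) • (show G → N from f) h =
        b • ∑ h, HS.u h • (show G → N from f) h
      rw [Finset.smul_sum, Finset.sum_congr rfl fun k _ ↦ Finset.smul_sum, Finset.sum_comm]
      refine Finset.sum_congr rfl fun h _ ↦ ?_
      have (k : G) (n : N) : HS.u k • HS.ι (HS.entry b k h) • n = HS.u k • b • HS.u h • n := by
        simp only [← mul_smul, u_mul_ι_entry, mul_assoc]
      rw [Finset.sum_congr rfl fun k _ ↦ this k _, ← Finset.sum_smul, HS.sum_u, one_smul] }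

/-- The identity functor of `A`-modules embeds into restriction after induction. -/
noncomputable def unitResInd : 𝟭 (ModuleCat.{u} A) ⟶ HS.ind ⋙ HS.res where
  app M := HS.toResInd M
  naturality _ _ _ := rfl

/-- The averaging map from restriction after induction to the identity functor. -/
noncomputable def averageResInd : HS.ind ⋙ HS.res ⟶ 𝟭 (ModuleCat.{u} A) where
  app M := HS.ofResInd M
  naturality M N f := by
    ext x
    exact (congrArg _ (map_sum f.hom _ _).symm).trans (map_smul f.hom _ _).symm

lemma unitResInd_comp_averageResInd (hchar : (Fintype.card G : K) ≠ 0) :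
    HS.unitResInd ≫ HS.averageResInd = 𝟙 _ := by
  ext M m
  change algebraMap K A (Fintype.card G : K)⁻¹ • ∑ k : G, m = m
  rw [Finset.sum_const, Finset.card_univ, ← Nat.cast_smul_eq_nsmul A, ← mul_smul,
    ← map_natCast (algebraMap K A), ← map_mul, inv_mul_cancel₀ hchar, map_one, one_smul]

/-- The identity functor of modules over the smash product embeds into induction after
restriction. -/
noncomputable def unitIndRes : 𝟭 (ModuleCat.{u} B) ⟶ HS.res ⋙ HS.ind where
  app N := HS.toIndRes N
  naturality M N f := by
    ext x
    exact funext fun k ↦ (map_smul f.hom (HS.u k) x).symm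

/-- The natural map from induction after restriction to the identity functor. -/
noncomputable def counitIndRes : HS.res ⋙ HS.ind ⟶ 𝟭 (ModuleCat.{u} B) where
  app N := HS.ofIndRes N
  naturality M N f := by
    ext x
    refine Eq.trans ?_ (map_sum f.hom (fun k ↦ HS.u k • (show G → M from x) k) _).symm
    exact Finset.sum_congr rfl fun k _ ↦ (map_smul f.hom (HS.u k) _).symm

lemma unitIndRes_comp_counitIndRes : HS.unitIndRes ≫ HS.counitIndRes = 𝟙 _ := by
  ext N n
  change ∑ k, HS.u k • HS.u k • n = n
  simp_rw [← mul_smul, HS.idem, ← Finset.sum_smul, HS.sum_u, one_smul]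

lemma finite_ind (M : ModuleCat.{u} A) [Module.Finite A M] : Module.Finite B (HS.ind.obj M) := by
  obtain ⟨n, s, hs⟩ := Module.Finite.exists_fin (R := A) (M := M)
  let v (p : G × Fin n) : HS.ind.obj M := (Pi.single p.1 (s p.2) : G → M)
  let W := Submodule.span B (Set.range v)
  have key (m : M) : ∀ k, (Pi.single k m : G → M) ∈ W := by
    have hm : m ∈ Submodule.span A (Set.range s) := hs ▸ Submodule.mem_top
    induction hm using Submodule.span_induction with
    | mem m h =>
      obtain ⟨i, rfl⟩ := h
      exact fun k ↦ Submodule.subset_span ⟨(k, i), rfl⟩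
    | zero => exact fun k ↦ by rw [Pi.single_zero]; exact W.zero_mem
    | add m m' _ _ h h' => exact fun k ↦ by rw [Pi.single_add]; exact W.add_mem (h k) (h' k)
    | smul a m _ ih =>
      intro k
      have : (Pi.single k (a • m) : G → M) =
          HS.u k • HS.ι a • (∑ h, (Pi.single h m : G → M) : HS.ind.obj M) := by
        have e : (∑ h, (Pi.single h m : G → M) : HS.ind.obj M) = HS.toResInd M m :=
          Finset.univ_sum_single fun _ : G ↦ m
        rw [e]
        have e' := (map_smul (HS.toResInd M).hom a m).symm
        refine Eq.trans ?_ (congrArg (fun f : HS.ind.obj M ↦ HS.u k • f) e'.symm)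
        refine funext fun l ↦ ?_
        change _ = ∑ h, HS.entry (HS.u k) l h • a • m
        simp_rw [entry_u]
        rcases eq_or_ne l k with rfl | hl
        · simp
        · simp [hl]
      rw [this]
      exact W.smul_mem _ (W.smul_mem _ (W.sum_mem fun h _ ↦ ih h))
  refine ⟨(Set.finite_range v).toFinset, ?_⟩
  rw [Set.Finite.coe_toFinset, eq_top_iff]
  rintro (f : G → M) -
  rw [← Finset.univ_sum_single f]
  exact W.sum_mem fun k _ ↦ key _ k

lemma jacRad_le_comap [FiniteDimensional K A] (hchar : (Fintype.card G : K) ≠ 0) :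
    jacRad A ≤ (jacRad B).comap (HS.ι : A →+* B) := by
  have := HS.finiteDimensional
  have : IsArtinianRing B := IsArtinianRing.of_finite K B
  set I := (jacRad B).comap (HS.ι : A →+* B)
  have : I.IsTwoSided := inferInstance
  let M := ModuleCat.of A (A ⧸ I)
  have := HS.finite_ind M
  have hind : IsSemisimpleModule B (HS.ind.obj M) := by
    refine isSemisimpleModule_of_jacRad_smul_eq_zero fun b hb f ↦ funext fun k ↦ ?_
    rw [ind_smul]
    refine Finset.sum_eq_zero fun h _ ↦ ?_
    obtain ⟨y, hy⟩ := Submodule.Quotient.mk_surjective I ((show G → A ⧸ I from f) h)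
    rw [← hy, ← Submodule.Quotient.mk_smul, Submodule.Quotient.mk_eq_zero]
    exact I.mul_mem_right y (HS.ι_entry_mem_jacRad hb k h)
  have hM : IsSemisimpleModule A (A ⧸ I) := by
    have : ComplementedLattice (Submodule A (A ⧸ I)) := by
      refine ⟨fun P ↦ ?_⟩
      let N := ModuleCat.of A P
      let j : N ⟶ M := ModuleCat.ofHom P.subtype
      obtain ⟨r, hr⟩ := IsSemisimpleModule.extension_property (HS.ind.map j).hom
        (fun f f' e ↦ funext fun k ↦ Subtype.ext (congrFun e k)) LinearMap.id
      let r' : HS.ind.obj M ⟶ HS.ind.obj N :=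
        ModuleCat.ofHom (X := HS.ind.obj M) (Y := HS.ind.obj N) r
      let q : M ⟶ N := HS.toResInd M ≫ HS.res.map r' ≫ HS.ofResInd N
      have hq : j ≫ q = 𝟙 N := by
        have h₁ : HS.res.map (HS.ind.map j) ≫ HS.res.map r' = 𝟙 _ := by
          rw [← Functor.map_comp, show HS.ind.map j ≫ r' = 𝟙 _ from ModuleCat.hom_ext hr,
            CategoryTheory.Functor.map_id]
        have h₂ : j ≫ HS.toResInd M = HS.toResInd N ≫ HS.res.map (HS.ind.map j) :=
          HS.unitResInd.naturality j
        have h₃ : HS.toResInd N ≫ HS.ofResInd N = 𝟙 N :=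
          NatTrans.congr_app (HS.unitResInd_comp_averageResInd hchar) N
        rw [← Category.assoc, h₂, Category.assoc, ← Category.assoc (HS.res.map _), h₁,
          Category.id_comp, h₃]
      exact ⟨LinearMap.ker q.hom, LinearMap.isCompl_of_proj fun p ↦
        LinearMap.congr_fun (congrArg ModuleCat.Hom.hom hq) p⟩
    exact { toComplementedLattice := this }
  intro a ha
  rw [jacRad_eq_jacobson] at ha
  have h := Module.mem_annihilator.1 (IsSemisimpleModule.jacobson_le_annihilator A (A ⧸ I) ha)
    (Submodule.Quotient.mk 1)
  rw [← Submodule.Quotient.mk_smul, Submodule.Quotient.mk_eq_zero] at h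
  simpa using h

lemma isSummandOfPower_res [FiniteDimensional K A] (hchar : (Fintype.card G : K) ≠ 0) :
    IsSummandOfPower (HS.res.obj (ssQuot B)) (ssQuot A) := by
  have : IsArtinianRing A := IsArtinianRing.of_finite K A
  have : Module.Finite A (HS.res.obj (ssQuot B)) := by
    let v (g : G) : HS.res.obj (ssQuot B) := (Submodule.Quotient.mk (HS.u g) : B ⧸ jacRad B)
    refine ⟨(Set.finite_range v).toFinset, ?_⟩
    rw [Set.Finite.coe_toFinset, eq_top_iff]
    rintro n -
    obtain ⟨b, rfl⟩ := Submodule.Quotient.mk_surjective (jacRad B) n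
    obtain ⟨c, rfl, -⟩ := HS.free b
    rw [← Submodule.mkQ_apply, map_sum]
    exact Submodule.sum_mem (Submodule.span A (Set.range v)) fun g _ ↦
      Submodule.smul_mem _ (c g) (Submodule.subset_span (Set.mem_range_self g))
  refine isSummandOfPower_ssQuot _ fun a ha n ↦ ?_
  obtain ⟨b, rfl⟩ := Submodule.Quotient.mk_surjective (jacRad B) n
  exact (Submodule.Quotient.mk_eq_zero _).2
    (Ideal.mul_mem_right b _ (HS.jacRad_le_comap hchar ha))

lemma isSummandOfPower_ind [FiniteDimensional K A] :
    IsSummandOfPower (HS.ind.obj (ssQuot A)) (ssQuot B) := by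
  have := HS.finiteDimensional
  have : IsArtinianRing B := IsArtinianRing.of_finite K B
  have := HS.finite_ind (ssQuot A)
  refine isSummandOfPower_ssQuot _ fun b hb f ↦ funext fun k ↦ ?_
  rw [ind_smul]
  refine Finset.sum_eq_zero fun h _ ↦ ?_
  obtain ⟨y, hy⟩ := Submodule.Quotient.mk_surjective (jacRad A) ((show G → A ⧸ jacRad A from f) h)
  rw [← hy, ← Submodule.Quotient.mk_smul, Submodule.Quotient.mk_eq_zero]
  exact Ideal.mul_mem_right y _ (HS.comap_jacRad_le (HS.ι_entry_mem_jacRad hb k h))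

end IsSmashProduct

/- STATEMENT 17: A finite-dimensional G-graded K-algebra A, with G finite and
char K ∤ |G|, is quasi-Koszul iff the smash product A # G^* is quasi-Koszul. -/

theorem stmt17 (K : Type u) [Field K] (A : Type u) [Ring A] [Algebra K A]
    [FiniteDimensional K A]
    (G : Type u) [Group G] [Fintype G] [DecidableEq G]
    (𝒜 : G → Submodule K A) [DirectSum.Decomposition 𝒜]
    (hone : (1 : A) ∈ 𝒜 1)
    (hmul : ∀ (g h : G) (a b : A), a ∈ 𝒜 g → b ∈ 𝒜 h → a * b ∈ 𝒜 (g * h))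
    (B : Type u) [Ring B] [Algebra K B]
    (HS : IsSmashProduct K A G 𝒜 B)
    (hchar : (Fintype.card G : K) ≠ 0) :
    IsQuasiKoszul A ↔ IsQuasiKoszul B := by
  obtain ⟨_, _⟩ := exact_restrictScalars (HS.ι : A →+* B)
  obtain ⟨_, _⟩ := exact_restrictScalars HS.toMatrix
  obtain ⟨_, _⟩ := exact_toMatrixModCat (R := A) G
  have : Limits.PreservesFiniteLimits HS.ind := Limits.comp_preservesFiniteLimits _ _
  have : Limits.PreservesFiniteColimits HS.ind := Limits.comp_preservesFiniteColimits _ _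
  have hA := HS.isSummandOfPower_res hchar
  have hB := HS.isSummandOfPower_ind
  exact ⟨fun h i ↦ extSpan_eq_top_of_retract HS.res HS.ind HS.unitIndRes HS.counitIndRes
      HS.unitIndRes_comp_counitIndRes hA hB (h i),
    fun h i ↦ extSpan_eq_top_of_retract HS.ind HS.res HS.unitResInd HS.averageResInd
      (HS.unitResInd_comp_averageResInd hchar) hB hA (h i)⟩
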